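/- arXiv:2307.12772 — 2 statements merged into one kernel-verified Lean document; each statement's English description precedes it below -/
import Mathlib

section
/- Let θ ∈ (0, 2π) with θ ≠ π, let η ∈ ℝ and set ξ := η + i/2 (a complex number). Then the function x ↦ x^{i·ξ̄} / (x² − 2x·cos θ + 1) is integrable on (0, ∞), and ∫₀^∞ x^{i·ξ̄} / (x² − 2x·cos θ + 1) dx = −π · sinh(ξ̄·(π − θ)) / (sin θ · sinh(ξ·π)). (Evaluation of the corner integral computed in the proof of Theorem 5.2 via the classical formula ∫₀^∞ x^{α−1}/(x² + 2bx·cos ω + b²) dx = −π b^{α−2} sin((α−1)ω)/(sin ω · sin(απ)).) -/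
open MeasureTheory

open Set Complex in
lemma integrableOn_cpow_mul_exp_neg_mul_Ioi {a r : ℂ} (ha : 0 < a.re) (hr : 0 < r.re) :
    IntegrableOn (fun t : ℝ ↦ (t : ℂ) ^ (a - 1) * exp (-(r * t))) (Ioi 0) := by
  have hreal : IntegrableOn (fun t : ℝ ↦ t ^ (a.re - 1) * Real.exp (-r.re * t)) (Ioi 0) := by
    simpa using integrableOn_rpow_mul_exp_neg_mul_rpow (p := 1) (s := a.re - 1) (by linarith)
      one_pos hr
  refine hreal.mono' (Measurable.aestronglyMeasurable (by fun_prop)) ?_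
  filter_upwards [ae_restrict_mem measurableSet_Ioi] with t ht
  rw [norm_mul, norm_cpow_eq_rpow_re_of_pos ht, norm_exp]
  simp

open Set Complex in
lemma hasDerivAt_integral_cpow_mul_exp_neg_mul_Ioi {a r : ℂ} (ha : 0 < a.re) (hr : 0 < r.re) :
    HasDerivAt (fun z : ℂ ↦ ∫ t : ℝ in Ioi 0, (t : ℂ) ^ (a - 1) * exp (-(z * t)))
      (∫ t : ℝ in Ioi 0, (t : ℂ) ^ (a - 1) * (exp (-(r * t)) * -(t : ℂ))) r := by
  have hbound : IntegrableOn (fun t : ℝ ↦ t ^ a.re * Real.exp (-(r.re / 2) * t)) (Ioi 0) := by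
    simpa using integrableOn_rpow_mul_exp_neg_mul_rpow (p := 1) (s := a.re) (by linarith)
      one_pos (half_pos hr)
  have hs : {z : ℂ | r.re / 2 < z.re} ∈ nhds r :=
    (isOpen_lt continuous_const continuous_re).mem_nhds (by simpa using hr)
  refine (hasDerivAt_integral_of_dominated_loc_of_deriv_le hs
    (μ := volume.restrict (Ioi 0))
    (F := fun z (t : ℝ) ↦ (t : ℂ) ^ (a - 1) * exp (-(z * t)))
    (bound := fun t : ℝ ↦ t ^ a.re * Real.exp (-(r.re / 2) * t))
    (F' := fun z (t : ℝ) ↦ (t : ℂ) ^ (a - 1) * (exp (-(z * t)) * -(t : ℂ)))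
    (.of_forall fun z ↦ Measurable.aestronglyMeasurable (by fun_prop))
    (integrableOn_cpow_mul_exp_neg_mul_Ioi ha hr)
    (Measurable.aestronglyMeasurable (by fun_prop)) ?_ hbound ?_).2
  · filter_upwards [ae_restrict_mem measurableSet_Ioi] with t ht z hz
    have ht : 0 < t := ht
    rw [norm_mul, norm_mul, norm_cpow_eq_rpow_re_of_pos ht, norm_exp, norm_neg, norm_real,
      Real.norm_of_nonneg ht.le, mul_comm (Real.exp _), ← mul_assoc, sub_re, one_re,
      Real.rpow_sub_one ht.ne', div_mul_cancel₀ _ ht.ne']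
    have : r.re / 2 * t ≤ z.re * t := mul_le_mul_of_nonneg_right (le_of_lt hz) ht.le
    gcongr
    simpa using this
  · refine .of_forall fun t z _ ↦ ?_
    have h : HasDerivAt (fun z : ℂ ↦ -(z * t)) (-(t : ℂ)) z := by
      simpa using! ((hasDerivAt_id z).mul_const (t : ℂ)).neg
    exact h.cexp.const_mul _

open Set Complex in
/-- Extension of `Complex.integral_cpow_mul_exp_neg_mul_Ioi` to complex `r`. -/
lemma integral_cpow_mul_exp_neg_complex_mul_Ioi {a r : ℂ} (ha : 0 < a.re) (hr : 0 < r.re) :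
    ∫ t : ℝ in Ioi 0, (t : ℂ) ^ (a - 1) * exp (-(r * t)) = r ^ (-a) * Gamma a := by
  have hopen : IsOpen {z : ℂ | 0 < z.re} := isOpen_lt continuous_const continuous_re
  have hconn : IsPreconnected {z : ℂ | 0 < z.re} := (convex_halfSpace_re_gt 0).isPreconnected
  have hF : AnalyticOnNhd ℂ (fun z : ℂ ↦ ∫ t : ℝ in Ioi 0, (t : ℂ) ^ (a - 1) * exp (-(z * t)))
      {z | 0 < z.re} :=
    DifferentiableOn.analyticOnNhd (fun z hz ↦ (hasDerivAt_integral_cpow_mul_exp_neg_mul_Ioi ha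
      hz).differentiableAt.differentiableWithinAt) hopen
  have hG : AnalyticOnNhd ℂ (fun z : ℂ ↦ z ^ (-a) * Gamma a) {z | 0 < z.re} :=
    DifferentiableOn.analyticOnNhd (fun z hz ↦
      ((differentiableAt_id.cpow_const (.inl hz)).mul_const _).differentiableWithinAt) hopen
  refine hF.eqOn_of_preconnected_of_frequently_eq hG hconn (z₀ := 1) (by simp) ?_ hr
  have htend : Filter.Tendsto ((↑) : ℝ → ℂ) (nhdsWithin 1 {1}ᶜ) (nhdsWithin 1 {1}ᶜ) := by
    refine tendsto_nhdsWithin_iff.2 ⟨?_, ?_⟩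
    · exact (continuous_ofReal.tendsto' 1 1 ofReal_one).mono_left nhdsWithin_le_nhds
    · filter_upwards [self_mem_nhdsWithin] with x hx
      simpa using hx
  refine htend.frequently (Filter.Eventually.frequently ?_)
  filter_upwards [nhdsWithin_le_nhds (lt_mem_nhds one_pos)] with x hx
  rw [integral_cpow_mul_exp_neg_mul_Ioi ha hx, one_div, ← ofReal_inv,
    ofReal_inv, inv_cpow _ _ (by rw [arg_ofReal_of_nonneg hx.le]; exact Real.pi_pos.ne), cpow_neg]

open Set Complex in
lemma integrable_cpow_mul_exp_neg_mul_prod {s c d : ℂ} (hs₀ : 0 < s.re) (hs₁ : s.re < 1)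
    (hc : 0 < c.re) (hd : 0 < d.re) :
    Integrable (Function.uncurry fun x t : ℝ ↦ (x : ℂ) ^ (s - 1) * exp (-((c * x + d) * t)))
      ((volume.restrict (Ioi 0)).prod (volume.restrict (Ioi 0))) := by
  have hnorm {x t : ℝ} (hx : 0 < x) : ‖(x : ℂ) ^ (s - 1) * exp (-((c * x + d) * t))‖ =
      x ^ (s.re - 1) * Real.exp (-(c.re * t * x)) * Real.exp (-(d.re * t)) := by
    rw [norm_mul, norm_cpow_eq_rpow_re_of_pos hx, norm_exp, mul_assoc, ← Real.exp_add]
    congr 2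
    simp
    ring
  refine (integrable_prod_iff' (Measurable.aestronglyMeasurable (by fun_prop))).2 ⟨?_, ?_⟩
  · filter_upwards [ae_restrict_mem measurableSet_Ioi] with t ht
    have ht : 0 < t := ht
    refine ((integrableOn_cpow_mul_exp_neg_mul_Ioi (r := c * t) hs₀
      (by simpa using mul_pos hc ht)).mul_const (exp (-(d * t)))).congr (.of_forall fun x ↦ ?_)
    simp only [Function.uncurry]
    rw [mul_assoc, ← exp_add]
    ring_nf
  · have hint : IntegrableOn (fun t : ℝ ↦ (1 / c.re) ^ s.re * Real.Gamma s.re *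
        (t ^ (-s.re) * Real.exp (-d.re * t))) (Ioi 0) := by
      refine Integrable.const_mul ?_ _
      simpa [IntegrableOn] using integrableOn_rpow_mul_exp_neg_mul_rpow (p := 1) (s := -s.re)
        (by linarith) one_pos hd
    refine hint.congr ?_
    filter_upwards [ae_restrict_mem measurableSet_Ioi] with t ht
    have ht : 0 < t := ht
    simp only [Function.uncurry]
    rw [setIntegral_congr_fun measurableSet_Ioi fun x hx ↦ hnorm hx, integral_mul_const,
      Real.integral_rpow_mul_exp_neg_mul_Ioi hs₀ (mul_pos hc ht), ← one_div_mul_one_div,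
      Real.mul_rpow (by positivity) (by positivity), Real.rpow_neg ht.le, one_div t,
      Real.inv_rpow ht.le]
    ring_nf

open Set Complex in
lemma integral_exp_neg_mul_Ioi_zero {z : ℂ} (hz : 0 < z.re) :
    ∫ t : ℝ in Ioi 0, exp (-(z * t)) = 1 / z := by
  simpa [neg_div_neg_eq] using integral_exp_mul_complex_Ioi (a := -z) (by simpa using hz) 0

open Set Complex in
lemma integrableOn_cpow_div_linear {s c d : ℂ} (hs₀ : 0 < s.re) (hs₁ : s.re < 1)
    (hc : 0 < c.re) (hd : 0 < d.re) :
    IntegrableOn (fun x : ℝ ↦ (x : ℂ) ^ (s - 1) / (c * x + d)) (Ioi 0) := by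
  refine (integrable_cpow_mul_exp_neg_mul_prod hs₀ hs₁ hc hd).integral_prod_left.congr ?_
  filter_upwards [ae_restrict_mem measurableSet_Ioi] with x hx
  have hre : 0 < (c * x + d).re := by simpa using add_pos (mul_pos hc hx) hd
  simp only [Function.uncurry]
  rw [integral_const_mul, integral_exp_neg_mul_Ioi_zero hre, mul_one_div]

open Set Complex in
lemma integral_cpow_div_linear {s c d : ℂ} (hs₀ : 0 < s.re) (hs₁ : s.re < 1)
    (hc : 0 < c.re) (hd : 0 < d.re) :
    ∫ x : ℝ in Ioi 0, (x : ℂ) ^ (s - 1) / (c * x + d) =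
      c ^ (-s) * d ^ (s - 1) * (Real.pi / sin (Real.pi * s)) := by
  have hc₀ : c ≠ 0 := fun h ↦ by simp [h] at hc
  calc
    _ = ∫ x : ℝ in Ioi 0, ∫ t : ℝ in Ioi 0, (x : ℂ) ^ (s - 1) * exp (-((c * x + d) * t)) := by
      refine setIntegral_congr_fun measurableSet_Ioi fun x hx ↦ ?_
      have hre : 0 < (c * x + d).re := by simpa using add_pos (mul_pos hc hx) hd
      rw [integral_const_mul, integral_exp_neg_mul_Ioi_zero hre, mul_one_div]
    _ = ∫ t : ℝ in Ioi 0, ∫ x : ℝ in Ioi 0, (x : ℂ) ^ (s - 1) * exp (-((c * x + d) * t)) :=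
      integral_integral_swap (integrable_cpow_mul_exp_neg_mul_prod hs₀ hs₁ hc hd)
    _ = ∫ t : ℝ in Ioi 0, c ^ (-s) * Gamma s * ((t : ℂ) ^ ((1 - s) - 1) * exp (-(d * t))) := by
      refine setIntegral_congr_fun measurableSet_Ioi fun t ht ↦ ?_
      have ht : 0 < t := ht
      have hsplit (x : ℝ) : (x : ℂ) ^ (s - 1) * exp (-((c * x + d) * t)) =
          (x : ℂ) ^ (s - 1) * exp (-(t * c * x)) * exp (-(d * t)) := by
        rw [mul_assoc, ← exp_add]
        ring_nf
      have hpow : (t * c : ℂ) ^ (-s) = (t : ℂ) ^ (-s) * c ^ (-s) := by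
        have ht₀ : (t : ℂ) ≠ 0 := ofReal_ne_zero.2 ht.ne'
        rw [cpow_def_of_ne_zero (mul_ne_zero ht₀ hc₀), cpow_def_of_ne_zero ht₀,
          cpow_def_of_ne_zero hc₀, log_ofReal_mul ht hc₀, ofReal_log ht.le, add_mul, exp_add]
      simp only [hsplit]
      rw [integral_mul_const, integral_cpow_mul_exp_neg_complex_mul_Ioi hs₀
        (by simpa using mul_pos ht hc), hpow, sub_sub_cancel_left]
      ring
    _ = _ := by
      rw [integral_const_mul, integral_cpow_mul_exp_neg_complex_mul_Ioi (by simpa using hs₁) hd,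
        ← Gamma_mul_Gamma_one_sub, neg_sub]
      ring

section

open Set Complex

variable {φ : ℝ}

lemma re_exp_half_pos (hφ : φ ∈ Ioo (-Real.pi) Real.pi) :
    0 < (exp ((φ / 2 : ℝ) * I)).re := by
  rw [exp_ofReal_mul_I_re]
  exact Real.cos_pos_of_mem_Ioo ⟨by linarith [hφ.1], by linarith [hφ.2]⟩

lemma re_exp_neg_half_pos (hφ : φ ∈ Ioo (-Real.pi) Real.pi) :
    0 < (exp (-((φ / 2 : ℝ) * I))).re := by
  rw [← neg_mul, ← ofReal_neg, exp_ofReal_mul_I_re, Real.cos_neg]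
  exact Real.cos_pos_of_mem_Ioo ⟨by linarith [hφ.1], by linarith [hφ.2]⟩

lemma cpow_div_quadratic_eq (hφ : φ ∈ Ioo (-Real.pi) Real.pi) (hsin : Real.sin φ ≠ 0)
    (s : ℂ) {x : ℝ} (hx : 0 < x) :
    (x : ℂ) ^ s / ((x ^ 2 + 2 * x * Real.cos φ + 1 : ℝ) : ℂ) =
      (exp ((φ / 2 : ℝ) * I) *
          ((x : ℂ) ^ (s - 1) / (exp (-((φ / 2 : ℝ) * I)) * x + exp ((φ / 2 : ℝ) * I))) -
        exp (-((φ / 2 : ℝ) * I)) *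
          ((x : ℂ) ^ (s - 1) / (exp ((φ / 2 : ℝ) * I) * x + exp (-((φ / 2 : ℝ) * I))))) /
        (2 * I * Real.sin φ) := by
  have hd := re_exp_half_pos hφ
  have hc := re_exp_neg_half_pos hφ
  have hcd : exp (-((φ / 2 : ℝ) * I)) * exp ((φ / 2 : ℝ) * I) = 1 := by
    rw [← exp_add]; simp
  have hd2 : exp ((φ / 2 : ℝ) * I) ^ 2 = Real.cos φ + Real.sin φ * I := by
    rw [← exp_nat_mul, ofReal_cos, ofReal_sin, ← exp_mul_I]
    push_cast; ring_nf
  have hc2 : exp (-((φ / 2 : ℝ) * I)) ^ 2 = Real.cos φ - Real.sin φ * I := by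
    rw [← exp_nat_mul, ofReal_cos, ofReal_sin, sub_eq_add_neg, ← neg_mul (sin _), ← sin_neg,
      ← cos_neg, ← exp_mul_I]
    push_cast; ring_nf
  generalize exp ((φ / 2 : ℝ) * I) = d at *
  generalize exp (-((φ / 2 : ℝ) * I)) = c at *
  have hne {a b : ℂ} (ha : 0 < a.re) (hb : 0 < b.re) : a * x + b ≠ 0 := fun h ↦ by
    have : 0 < (a * x + b).re := by simpa using add_pos (mul_pos ha hx) hb
    simp [h] at this
  have h₁ := hne hc hd
  have h₂ := hne hd hc
  have hx₀ : (x : ℂ) ≠ 0 := ofReal_ne_zero.2 hx.ne'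
  have hsin' : (Real.sin φ : ℂ) ≠ 0 := ofReal_ne_zero.2 hsin
  have hquad : ((x ^ 2 + 2 * x * Real.cos φ + 1 : ℝ) : ℂ) = (c * x + d) * (d * x + c) := by
    rw [ofReal_add, ofReal_add, ofReal_mul, ofReal_mul, ofReal_pow]
    push_cast only [ofReal_one, ofReal_ofNat]
    linear_combination (-(x : ℂ) ^ 2 - 1) * hcd - x * hd2 - x * hc2
  rw [hquad, cpow_sub _ _ hx₀, cpow_one]
  generalize (Real.sin φ : ℂ) = S at *
  have hpartial : x * (2 * I * S) = d * (d * x + c) - c * (c * x + d) := by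
    linear_combination x * hc2 - x * hd2
  generalize c * (x : ℂ) + d = p at *
  generalize d * (x : ℂ) + c = q at *
  field_simp
  linear_combination (x : ℂ) ^ s * hpartial

lemma integrableOn_cpow_div_quadratic (hφ : φ ∈ Ioo (-Real.pi) Real.pi) (hsin : Real.sin φ ≠ 0)
    {s : ℂ} (hs₀ : 0 < s.re) (hs₁ : s.re < 1) :
    IntegrableOn (fun x : ℝ ↦ (x : ℂ) ^ s / ((x ^ 2 + 2 * x * Real.cos φ + 1 : ℝ) : ℂ))
      (Ioi 0) :=
  ((((integrableOn_cpow_div_linear hs₀ hs₁ (re_exp_neg_half_pos hφ) (re_exp_half_pos hφ)).const_mul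
      _).sub ((integrableOn_cpow_div_linear hs₀ hs₁ (re_exp_half_pos hφ)
        (re_exp_neg_half_pos hφ)).const_mul _)).div_const _).congr <| by
    filter_upwards [ae_restrict_mem measurableSet_Ioi] with x hx
    exact (cpow_div_quadratic_eq hφ hsin s hx).symm

lemma integral_cpow_div_quadratic (hφ : φ ∈ Ioo (-Real.pi) Real.pi) (hsin : Real.sin φ ≠ 0)
    {s : ℂ} (hs₀ : 0 < s.re) (hs₁ : s.re < 1) :
    ∫ x : ℝ in Ioi 0, (x : ℂ) ^ s / ((x ^ 2 + 2 * x * Real.cos φ + 1 : ℝ) : ℂ) =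
      Real.pi * sin (φ * s) / (Real.sin φ * sin (Real.pi * s)) := by
  have hd := re_exp_half_pos hφ
  have hc := re_exp_neg_half_pos hφ
  have hpow (a : ℂ) : exp ((φ / 2 : ℝ) * I) ^ a = exp ((φ / 2 : ℝ) * I * a) := by
    rw [cpow_def_of_ne_zero (exp_ne_zero _), log_exp] <;> simp <;> linarith [hφ.1, hφ.2]
  have hpow_neg (a : ℂ) : exp (-((φ / 2 : ℝ) * I)) ^ a = exp (-((φ / 2 : ℝ) * I) * a) := by
    rw [cpow_def_of_ne_zero (exp_ne_zero _), log_exp] <;> simp <;> linarith [hφ.1, hφ.2]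
  rw [setIntegral_congr_fun measurableSet_Ioi fun x hx ↦ cpow_div_quadratic_eq hφ hsin s hx,
    integral_div, integral_sub ((integrableOn_cpow_div_linear hs₀ hs₁ hc hd).const_mul _)
      ((integrableOn_cpow_div_linear hs₀ hs₁ hd hc).const_mul _), integral_const_mul,
    integral_const_mul, integral_cpow_div_linear hs₀ hs₁ hc hd,
    integral_cpow_div_linear hs₀ hs₁ hd hc, hpow, hpow, hpow_neg, hpow_neg]
  have h₁ : exp ((φ / 2 : ℝ) * I) *
      (exp (-((φ / 2 : ℝ) * I) * -s) * exp ((φ / 2 : ℝ) * I * (s - 1))) =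
      exp (φ * s * I) := by
    rw [← exp_add, ← exp_add]; push_cast; ring_nf
  have h₂ : exp (-((φ / 2 : ℝ) * I)) *
      (exp ((φ / 2 : ℝ) * I * -s) * exp (-((φ / 2 : ℝ) * I) * (s - 1))) =
      exp (-(φ * s) * I) := by
    rw [← exp_add, ← exp_add]; push_cast; ring_nf
  rw [← mul_assoc, ← mul_assoc (exp (-((φ / 2 : ℝ) * I))), h₁, h₂, ← sub_mul,
    ← mul_div_mul_left (Real.pi * sin (φ * s)) _ (mul_ne_zero two_ne_zero I_ne_zero)]
  have h₃ : exp (φ * s * I) - exp (-(φ * s) * I) = 2 * I * sin (φ * s) := by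
    rw [exp_mul_I, exp_mul_I, cos_neg, sin_neg]; ring
  rw [h₃, mul_div_assoc', div_div]
  ring_nf

end

theorem stmt_10 (θ : ℝ) (hθ : θ ∈ Set.Ioo 0 (2 * Real.pi)) (hθπ : θ ≠ Real.pi)
    (η : ℝ) (ξ : ℂ) (hξ : ξ = η + Complex.I / 2) :
    IntegrableOn
        (fun x : ℝ => (x : ℂ) ^ (Complex.I * (starRingEnd ℂ) ξ) /
          ((x ^ 2 - 2 * x * Real.cos θ + 1 : ℝ) : ℂ)) (Set.Ioi 0) volume ∧
      ∫ x : ℝ in Set.Ioi 0,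
          (x : ℂ) ^ (Complex.I * (starRingEnd ℂ) ξ) /
            ((x ^ 2 - 2 * x * Real.cos θ + 1 : ℝ) : ℂ) =
        -Real.pi * Complex.sinh ((starRingEnd ℂ) ξ * (Real.pi - θ)) /
          ((Real.sin θ : ℂ) * Complex.sinh (ξ * Real.pi)) := by
  have hφ : θ - Real.pi ∈ Set.Ioo (-Real.pi) Real.pi :=
    ⟨by linarith [hθ.1], by linarith [hθ.2]⟩
  have hsin : Real.sin (θ - Real.pi) ≠ 0 := fun h ↦ hθπ <| sub_eq_zero.1 <|
    (Real.sin_eq_zero_iff_of_lt_of_lt hφ.1 hφ.2).1 h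
  have hconj : Complex.I * (starRingEnd ℂ) ξ = Complex.I * η + (1 / 2 : ℝ) := by
    rw [hξ]
    simp [map_ofNat]
    linear_combination (-1 / 2 : ℂ) * Complex.I_sq
  have hre : (Complex.I * (starRingEnd ℂ) ξ).re = 1 / 2 := by
    rw [hconj]
    simp
  have hquad (x : ℝ) : x ^ 2 - 2 * x * Real.cos θ + 1 =
      x ^ 2 + 2 * x * Real.cos (θ - Real.pi) + 1 := by
    rw [Real.cos_sub_pi]; ring
  have hs₀ : 0 < (Complex.I * (starRingEnd ℂ) ξ).re := by rw [hre]; norm_num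
  have hs₁ : (Complex.I * (starRingEnd ℂ) ξ).re < 1 := by rw [hre]; norm_num
  simp only [hquad]
  refine ⟨integrableOn_cpow_div_quadratic hφ hsin hs₀ hs₁, ?_⟩
  have hnum : Complex.sin ((θ - Real.pi : ℝ) * (Complex.I * (starRingEnd ℂ) ξ)) =
      -(Complex.sinh ((starRingEnd ℂ) ξ * (Real.pi - θ)) * Complex.I) := by
    rw [← Complex.sin_mul_I, ← Complex.sin_neg]
    push_cast
    ring_nf
  have hden : Complex.sin (Real.pi * (Complex.I * (starRingEnd ℂ) ξ)) =
      -(Complex.sinh (ξ * Real.pi) * Complex.I) := by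
    rw [← Complex.sin_mul_I, ← Complex.sin_add_pi, hconj, hξ]
    congr 1
    push_cast
    linear_combination (-Real.pi / 2 : ℂ) * Complex.I_sq
  rw [integral_cpow_div_quadratic hφ hsin hs₀ hs₁, hnum, hden, Real.sin_sub_pi, Complex.ofReal_neg]
  rw [← mul_div_mul_right (-Real.pi * _ : ℂ) _ Complex.I_ne_zero]
  ring_nf
end

section
/- Let θ ∈ (0, 2π) with θ ≠ π, let η ∈ ℝ and set ξ := η + i/2 (a complex number). Then the function x ↦ x^{i·ξ} / (x² − 2x·cos θ + 1) is integrable on (0, ∞), and ∫₀^∞ x^{i·ξ} / (x² − 2x·cos θ + 1) dx = −π · sinh(ξ·(π − θ)) / (sin θ · sinh(ξ̄·π)). (Evaluation of the second corner integral computed in the proof of Theorem 5.2.) -/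
open MeasureTheory

open Set Filter Topology

theorem image_div_one_add_Ioi : (fun x : ℝ => x / (1 + x)) '' Ioi 0 = Ioo 0 1 := by
  ext y
  simp only [mem_image, mem_Ioi, mem_Ioo]
  constructor
  · rintro ⟨x, hx, rfl⟩
    exact ⟨by positivity, by rw [div_lt_one (by positivity)]; linarith⟩
  · rintro ⟨h0, h1⟩
    have h : 0 < 1 - y := by linarith
    refine ⟨y / (1 - y), by positivity, ?_⟩
    field_simp
    ring

theorem hasDerivWithinAt_div_one_add {x : ℝ} (hx : x ∈ Ioi (0 : ℝ)) :
    HasDerivWithinAt (fun x : ℝ => x / (1 + x)) (1 / (1 + x) ^ 2) (Ioi 0) x := by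
  have h : 1 + x ≠ 0 := by have : 0 < x := hx; positivity
  have := (hasDerivAt_id x).div ((hasDerivAt_id x).const_add 1) h
  exact (this.congr_deriv (by simp)).hasDerivWithinAt

theorem injOn_div_one_add : InjOn (fun x : ℝ => x / (1 + x)) (Ioi 0) := by
  intro x hx y hy h
  have hx : 0 < x := hx
  have hy : 0 < y := hy
  have h : x / (1 + x) = y / (1 + y) := h
  rw [div_eq_div_iff (by positivity) (by positivity)] at h
  linarith

theorem abs_deriv_smul_beta_integrand (s : ℂ) {x : ℝ} (hx : 0 < x) :
    |1 / (1 + x) ^ 2| • (((x / (1 + x) : ℝ) : ℂ) ^ (s - 1) *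
      (1 - ((x / (1 + x) : ℝ) : ℂ)) ^ (1 - s - 1)) =
    (x : ℂ) ^ (s - 1) • ((x : ℂ) + 1)⁻¹ := by
  have h1 : (0 : ℝ) < 1 + x := by positivity
  have h2 : ((1 + x : ℝ) : ℂ) ≠ 0 := by exact_mod_cast h1.ne'
  have e1 : (1 - ((x / (1 + x) : ℝ) : ℂ)) = (((1 + x)⁻¹ : ℝ) : ℂ) := by
    rw [← Complex.ofReal_one, ← Complex.ofReal_sub]
    congr 1
    field_simp
    ring
  have e2 : ((x / (1 + x) : ℝ) : ℂ) = (x : ℂ) * (((1 + x)⁻¹ : ℝ) : ℂ) := by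
    push_cast
    ring
  rw [e1, e2, Complex.mul_cpow_ofReal_nonneg hx.le (by positivity), mul_assoc,
    ← Complex.cpow_add _ _ (by exact_mod_cast (inv_pos.2 h1).ne'),
    show s - 1 + (1 - s - 1) = -1 by ring, Complex.cpow_neg_one, abs_of_pos (by positivity),
    Complex.real_smul, smul_eq_mul]
  push_cast at h2 ⊢
  have h3 : (x : ℂ) + 1 ≠ 0 := by rwa [add_comm]
  field_simp
  ring

/-- The Mellin transform of `(x + 1)⁻¹`, from the Beta integral. -/
theorem hasMellin_inv_add_one {s : ℂ} (h0 : 0 < s.re) (h1 : s.re < 1) :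
    HasMellin (fun x : ℝ => ((x : ℂ) + 1)⁻¹) s (Real.pi / Complex.sin (Real.pi * s)) := by
  have h1' : 0 < (1 - s).re := by simpa using h1
  have hc : EqOn (fun x : ℝ => |1 / (1 + x) ^ 2| • (((x / (1 + x) : ℝ) : ℂ) ^ (s - 1) *
      (1 - ((x / (1 + x) : ℝ) : ℂ)) ^ (1 - s - 1)))
      (fun x : ℝ => (x : ℂ) ^ (s - 1) • ((x : ℂ) + 1)⁻¹) (Ioi 0) :=
    fun x hx => abs_deriv_smul_beta_integrand s hx
  constructor
  · have := Complex.betaIntegral_convergent h0 h1'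
    rw [intervalIntegrable_iff_integrableOn_Ioo_of_le zero_le_one, ← image_div_one_add_Ioi,
      integrableOn_image_iff_integrableOn_abs_deriv_smul measurableSet_Ioi
        (fun x hx => hasDerivWithinAt_div_one_add hx) injOn_div_one_add] at this
    exact this.congr_fun hc measurableSet_Ioi
  · have := Complex.Gamma_mul_Gamma_eq_betaIntegral h0 h1'
    rw [Complex.Gamma_mul_Gamma_one_sub, add_sub_cancel, Complex.Gamma_one, one_mul,
      Complex.betaIntegral, intervalIntegral.integral_of_le zero_le_one,
      integral_Ioc_eq_integral_Ioo, ← image_div_one_add_Ioi,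
      integral_image_eq_integral_abs_deriv_smul measurableSet_Ioi
        (fun x hx => hasDerivWithinAt_div_one_add hx) injOn_div_one_add] at this
    rw [this, mellin]
    exact (setIntegral_congr_fun measurableSet_Ioi hc).symm

theorem exists_mul_one_add_le_norm_add {w : ℂ} (hw : w ∈ Complex.slitPlane) :
    ∃ c : ℝ, 0 < c ∧ ∀ x : ℝ, 0 ≤ x → c * (1 + x) ≤ ‖(x : ℂ) + w‖ := by
  rcases Complex.mem_slitPlane_iff.1 hw with h | h
  · refine ⟨min 1 w.re, lt_min one_pos h, fun x hx => ?_⟩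
    have h1 := Complex.re_le_norm ((x : ℂ) + w)
    simp only [Complex.add_re, Complex.ofReal_re] at h1
    nlinarith [min_le_left 1 w.re, min_le_right 1 w.re]
  · have hi : 0 < |w.im| := abs_pos.2 h
    have hd : 0 < |w.im| + (1 + ‖w‖) := by positivity
    refine ⟨|w.im| / (|w.im| + (1 + ‖w‖)), by positivity, fun x hx => ?_⟩
    have h1 := Complex.abs_im_le_norm ((x : ℂ) + w)
    simp only [Complex.add_im, Complex.ofReal_im, zero_add] at h1
    have h2 : x ≤ ‖(x : ℂ) + w‖ + ‖w‖ := by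
      have := norm_sub_le ((x : ℂ) + w) w
      rwa [add_sub_cancel_right, Complex.norm_real, Real.norm_of_nonneg hx] at this
    rw [div_mul_eq_mul_div, div_le_iff₀ hd]
    nlinarith [mul_le_mul_of_nonneg_left h2 hi.le,
      mul_le_mul_of_nonneg_right h1 (by positivity : 0 ≤ 1 + ‖w‖)]

theorem exists_mul_one_add_le_norm_add_ball {w₀ : ℂ} (hw : w₀ ∈ Complex.slitPlane) :
    ∃ c : ℝ, 0 < c ∧ ∀ w ∈ Metric.ball w₀ c, ∀ x : ℝ, 0 ≤ x →
      c * (1 + x) ≤ ‖(x : ℂ) + w‖ := by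
  obtain ⟨c, hc, h⟩ := exists_mul_one_add_le_norm_add hw
  refine ⟨c / 2, by positivity, fun w hw x hx => ?_⟩
  have h1 := h x hx
  rw [mem_ball_iff_norm'] at hw
  have h2 := norm_add_le ((x : ℂ) + w) (w₀ - w)
  rw [show (x : ℂ) + w + (w₀ - w) = x + w₀ by ring] at h2
  nlinarith

theorem norm_ofReal_add_one {x : ℝ} (hx : 0 ≤ x) : ‖(x : ℂ) + 1‖ = 1 + x := by
  rw [← Complex.ofReal_one, ← Complex.ofReal_add, Complex.norm_real,
    Real.norm_of_nonneg (by positivity), add_comm]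

theorem continuousOn_cpow_Ioi (s : ℂ) : ContinuousOn (fun x : ℝ => (x : ℂ) ^ s) (Ioi 0) :=
  fun _ hx => (Complex.continuousAt_ofReal_cpow_const _ _
    (Or.inr (ne_of_gt hx))).continuousWithinAt

theorem ofReal_add_ne_zero {w : ℂ} (hw : w ∈ Complex.slitPlane) {x : ℝ} (hx : 0 ≤ x) :
    (x : ℂ) + w ≠ 0 := by
  obtain ⟨c, hc, h⟩ := exists_mul_one_add_le_norm_add hw
  exact norm_pos_iff.1 (lt_of_lt_of_le (by positivity) (h x hx))

theorem continuousOn_inv_add {w : ℂ} (hw : w ∈ Complex.slitPlane) :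
    ContinuousOn (fun x : ℝ => ((x : ℂ) + w)⁻¹) (Ioi 0) :=
  ContinuousOn.inv₀ (by fun_prop) fun _ hx => ofReal_add_ne_zero hw (le_of_lt hx)

theorem mellinConvergent_inv_add {s : ℂ} (h0 : 0 < s.re) (h1 : s.re < 1) {w : ℂ}
    (hw : w ∈ Complex.slitPlane) : MellinConvergent (fun x : ℝ => ((x : ℂ) + w)⁻¹) s := by
  obtain ⟨c, hc, h⟩ := exists_mul_one_add_le_norm_add hw
  refine Integrable.mono' ((hasMellin_inv_add_one h0 h1).1.norm.const_mul c⁻¹)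
    (((continuousOn_cpow_Ioi _).smul (continuousOn_inv_add hw)).aestronglyMeasurable
      measurableSet_Ioi) ?_
  refine (ae_restrict_iff' measurableSet_Ioi).2 (.of_forall fun x (hx : 0 < x) => ?_)
  simp only [norm_smul, norm_inv, norm_ofReal_add_one hx.le]
  rw [mul_left_comm, ← mul_inv]
  gcongr
  exact h x hx.le

theorem differentiableOn_mellin_inv_add {s : ℂ} (h0 : 0 < s.re) (h1 : s.re < 1) :
    DifferentiableOn ℂ (fun w : ℂ => mellin (fun x : ℝ => ((x : ℂ) + w)⁻¹) s)
      Complex.slitPlane := by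
  intro w₀ hw₀
  obtain ⟨c, hc, h⟩ := exists_mul_one_add_le_norm_add_ball hw₀
  have hne : ∀ w ∈ Metric.ball w₀ c, ∀ x : ℝ, 0 < x → (x : ℂ) + w ≠ 0 := fun w hw x hx =>
    norm_pos_iff.1 (lt_of_lt_of_le (by positivity) (h w hw x hx.le))
  refine (hasDerivAt_integral_of_dominated_loc_of_deriv_le (𝕜 := ℂ)
    (μ := volume.restrict (Ioi (0 : ℝ)))
    (F := fun w x => (x : ℂ) ^ (s - 1) • ((x : ℂ) + w)⁻¹)
    (F' := fun w x => (x : ℂ) ^ (s - 1) • (-1 / ((x : ℂ) + w) ^ 2))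
    (bound := fun x => (c ^ 2)⁻¹ * ‖(x : ℂ) ^ (s - 1) • ((x : ℂ) + 1)⁻¹‖)
    (Metric.ball_mem_nhds w₀ hc) ?_ (mellinConvergent_inv_add h0 h1 hw₀) ?_ ?_
    ((hasMellin_inv_add_one h0 h1).1.norm.const_mul _) ?_).2.differentiableAt.differentiableWithinAt
  · filter_upwards [Complex.isOpen_slitPlane.mem_nhds hw₀] with w hw
    exact (mellinConvergent_inv_add h0 h1 hw).1
  · refine ((continuousOn_cpow_Ioi _).smul ?_).aestronglyMeasurable measurableSet_Ioi
    exact ContinuousOn.div (by fun_prop) (by fun_prop) fun x hx =>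
      pow_ne_zero 2 (ofReal_add_ne_zero hw₀ (le_of_lt hx))
  · refine (ae_restrict_iff' measurableSet_Ioi).2 (.of_forall fun x (hx : 0 < x) w hw => ?_)
    simp only [norm_smul, norm_inv, norm_div, norm_neg, norm_one, norm_pow,
      norm_ofReal_add_one hx.le, one_div]
    rw [mul_left_comm, ← mul_inv]
    gcongr
    calc c ^ 2 * (1 + x) ≤ (c * (1 + x)) ^ 2 := by
          rw [mul_pow]
          gcongr
          nlinarith
      _ ≤ _ := by
          gcongr
          exact h w hw x hx.le
  · refine (ae_restrict_iff' measurableSet_Ioi).2 (.of_forall fun x (hx : 0 < x) w hw => ?_)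
    exact (((hasDerivAt_id w).const_add (x : ℂ)).fun_inv (hne w hw x hx)).const_mul _

theorem mellin_inv_add_ofReal {s : ℂ} (h0 : 0 < s.re) (h1 : s.re < 1) {r : ℝ} (hr : 0 < r) :
    mellin (fun x : ℝ => ((x : ℂ) + r)⁻¹) s =
      Real.pi / Complex.sin (Real.pi * s) * (r : ℂ) ^ (s - 1) := by
  have hr' : (r : ℂ) ≠ 0 := by exact_mod_cast hr.ne'
  have e : (fun x : ℝ => ((x : ℂ) + r)⁻¹) =
      fun x : ℝ => (r : ℂ)⁻¹ • (fun y : ℝ => ((y : ℂ) + 1)⁻¹) (r⁻¹ * x) := by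
    funext x
    rw [smul_eq_mul, ← mul_inv]
    push_cast
    field_simp
  rw [e, mellin_const_smul,
    mellin_comp_mul_left (fun y : ℝ => ((y : ℂ) + 1)⁻¹) _ (inv_pos.2 hr),
    (hasMellin_inv_add_one h0 h1).2, Complex.ofReal_inv, Complex.inv_cpow, Complex.cpow_neg,
    inv_inv, Complex.cpow_sub _ _ hr', Complex.cpow_one, smul_eq_mul, smul_eq_mul]
  · ring
  · rw [Complex.arg_ofReal_of_nonneg hr.le]
    exact Real.pi_pos.ne

theorem mellin_inv_add {s : ℂ} (h0 : 0 < s.re) (h1 : s.re < 1) {w : ℂ}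
    (hw : w ∈ Complex.slitPlane) :
    mellin (fun x : ℝ => ((x : ℂ) + w)⁻¹) s =
      Real.pi / Complex.sin (Real.pi * s) * w ^ (s - 1) := by
  have hg : DifferentiableOn ℂ
      (fun w : ℂ => Real.pi / Complex.sin (Real.pi * s) * w ^ (s - 1)) Complex.slitPlane :=
    fun w hw => ((differentiableAt_id.cpow_const hw).const_mul _).differentiableWithinAt
  refine ((differentiableOn_mellin_inv_add h0 h1).analyticOnNhd
    Complex.isOpen_slitPlane).eqOn_of_preconnected_of_frequently_eq
    (hg.analyticOnNhd Complex.isOpen_slitPlane)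
    (Complex.starConvex_one_slitPlane.isPathConnected
      Complex.one_mem_slitPlane).isConnected.isPreconnected Complex.one_mem_slitPlane ?_ hw
  have ht : Tendsto (fun r : ℝ => (r : ℂ)) (𝓝[>] 1) (𝓝[≠] 1) := by
    refine tendsto_nhdsWithin_iff.2 ⟨?_, ?_⟩
    · exact (Complex.continuous_ofReal.tendsto' 1 1 rfl).mono_left nhdsWithin_le_nhds
    · filter_upwards [self_mem_nhdsWithin] with r hr
      simpa using (ne_of_gt hr : r ≠ 1)
  refine ht.frequently (Eventually.frequently ?_)
  filter_upwards [self_mem_nhdsWithin] with r hr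
  exact mellin_inv_add_ofReal h0 h1 (zero_lt_one.trans hr)

theorem exp_mul_I_mem_slitPlane {t : ℝ} (h : t ∈ Ioo (-Real.pi) Real.pi) :
    Complex.exp (t * Complex.I) ∈ Complex.slitPlane := by
  rw [Complex.mem_slitPlane_iff_arg, Complex.arg_exp_mul_I, (toIocMod_eq_self _).2]
  · exact ⟨h.2.ne, Complex.exp_ne_zero _⟩
  · exact ⟨h.1, by linarith [h.2]⟩

theorem exp_mul_I_cpow {t : ℝ} (h : t ∈ Ioo (-Real.pi) Real.pi) (a : ℂ) :
    Complex.exp (t * Complex.I) ^ a = Complex.exp (t * Complex.I * a) := by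
  rw [Complex.cpow_def_of_ne_zero (Complex.exp_ne_zero _), Complex.log_exp]
  · simpa using h.1
  · simpa using h.2.le

/-- The Mellin transform of `(x² + 2 x cos t + 1)⁻¹`, by partial fractions. -/
theorem hasMellin_inv_quadratic {s : ℂ} (h0 : 0 < s.re) (h1 : s.re < 1) {t : ℝ}
    (h : t ∈ Ioo (-Real.pi) Real.pi) (ht : t ≠ 0) :
    HasMellin (fun x : ℝ => ((x ^ 2 + 2 * x * Real.cos t + 1 : ℝ) : ℂ)⁻¹) s
      (-Real.pi * Complex.sin (t * (s - 1)) /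
        (Real.sin t * Complex.sin (Real.pi * s))) := by
  have h' : -t ∈ Ioo (-Real.pi) Real.pi := ⟨by linarith [h.2], by linarith [h.1]⟩
  have hw := exp_mul_I_mem_slitPlane h
  have hw' := exp_mul_I_mem_slitPlane h'
  have hsin : Real.sin t ≠ 0 := by
    rw [Ne, Real.sin_eq_zero_iff_of_lt_of_lt h.1 h.2]
    exact ht
  have hsin' : Complex.sin t ≠ 0 := by exact_mod_cast hsin
  have hE : Complex.exp (t * Complex.I) = Complex.cos t + Complex.sin t * Complex.I :=
    Complex.exp_mul_I _
  have hE' : Complex.exp ((-t : ℝ) * Complex.I) = Complex.cos t - Complex.sin t * Complex.I := by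
    rw [Complex.exp_mul_I]
    simp [sub_eq_add_neg]
  have hM := hasMellin_sub (mellinConvergent_inv_add h0 h1 hw') (mellinConvergent_inv_add h0 h1 hw)
  have hpf : EqOn (fun x : ℝ => (x : ℂ) ^ (s - 1) •
        ((2 * Complex.I * Complex.sin t)⁻¹ • (((x : ℂ) + Complex.exp ((-t : ℝ) * Complex.I))⁻¹ -
          ((x : ℂ) + Complex.exp (t * Complex.I))⁻¹)))
      (fun x : ℝ => (x : ℂ) ^ (s - 1) • ((x ^ 2 + 2 * x * Real.cos t + 1 : ℝ) : ℂ)⁻¹)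
      (Ioi 0) := by
    intro x hx
    have n1 := ofReal_add_ne_zero hw (le_of_lt hx)
    have n2 := ofReal_add_ne_zero hw' (le_of_lt hx)
    have e : ((x ^ 2 + 2 * x * Real.cos t + 1 : ℝ) : ℂ) =
        ((x : ℂ) + Complex.exp (t * Complex.I)) * ((x : ℂ) + Complex.exp ((-t : ℝ) * Complex.I)) := by
      rw [hE, hE']
      push_cast
      linear_combination Complex.sin t ^ 2 * Complex.I_sq - Complex.sin_sq_add_cos_sq (t : ℂ)
    have d : Complex.exp (t * Complex.I) - Complex.exp ((-t : ℝ) * Complex.I) =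
        2 * Complex.I * Complex.sin t := by
      rw [hE, hE']
      ring
    have hI := Complex.I_ne_zero
    simp only [e]
    rw [inv_sub_inv n2 n1, add_sub_add_left_eq_sub, d, smul_eq_mul (_⁻¹), ← mul_div_assoc,
      inv_mul_cancel₀ (by simp [hsin', hI]), one_div, mul_comm ((x : ℂ) + _)]
  have hMc := hM.1.const_smul (2 * Complex.I * Complex.sin t)⁻¹
  constructor
  · exact IntegrableOn.congr_fun hMc hpf measurableSet_Ioi
  · rw [mellin, ← setIntegral_congr_fun measurableSet_Ioi hpf]
    change mellin (fun x : ℝ => (2 * Complex.I * Complex.sin t)⁻¹ •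
      (((x : ℂ) + Complex.exp ((-t : ℝ) * Complex.I))⁻¹ -
          ((x : ℂ) + Complex.exp (t * Complex.I))⁻¹)) s = _
    rw [mellin_const_smul, hM.2, mellin_inv_add h0 h1 hw, mellin_inv_add h0 h1 hw',
      exp_mul_I_cpow h, exp_mul_I_cpow h', Complex.ofReal_sin, ← mul_sub, smul_eq_mul,
      Complex.sin.eq_1 (t * (s - 1))]
    have e1 : ((-t : ℝ) : ℂ) * Complex.I * (s - 1) = -(t * (s - 1)) * Complex.I := by
      push_cast
      ring
    have e2 : (t : ℂ) * Complex.I * (s - 1) = t * (s - 1) * Complex.I := by ring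
    rw [e1, e2, mul_inv, mul_inv, Complex.inv_I]
    ring

theorem stmt_11 (θ : ℝ) (hθ : θ ∈ Set.Ioo 0 (2 * Real.pi)) (hθπ : θ ≠ Real.pi)
    (η : ℝ) (ξ : ℂ) (hξ : ξ = η + Complex.I / 2) :
    IntegrableOn
        (fun x : ℝ => (x : ℂ) ^ (Complex.I * ξ) /
          ((x ^ 2 - 2 * x * Real.cos θ + 1 : ℝ) : ℂ)) (Set.Ioi 0) volume ∧
      ∫ x : ℝ in Set.Ioi 0,
          (x : ℂ) ^ (Complex.I * ξ) /
            ((x ^ 2 - 2 * x * Real.cos θ + 1 : ℝ) : ℂ) =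
        -Real.pi * Complex.sinh (ξ * (Real.pi - θ)) /
          ((Real.sin θ : ℂ) * Complex.sinh ((starRingEnd ℂ) ξ * Real.pi)) := by
  have hre : (Complex.I * ξ + 1).re = 1 / 2 := by
    simp [hξ]
    norm_num
  have hM := hasMellin_inv_quadratic (s := Complex.I * ξ + 1) (t := Real.pi - θ)
    (by rw [hre]; norm_num) (by rw [hre]; norm_num)
    ⟨by linarith [hθ.2], by linarith [hθ.1]⟩ (sub_ne_zero.2 hθπ.symm)
  have hf : (fun x : ℝ => (x : ℂ) ^ (Complex.I * ξ + 1 - 1) •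
        ((x ^ 2 + 2 * x * Real.cos (Real.pi - θ) + 1 : ℝ) : ℂ)⁻¹) =
      fun x : ℝ => (x : ℂ) ^ (Complex.I * ξ) /
          ((x ^ 2 - 2 * x * Real.cos θ + 1 : ℝ) : ℂ) := by
    funext x
    rw [add_sub_cancel_right, Real.cos_pi_sub, smul_eq_mul, ← div_eq_mul_inv, mul_neg,
      ← sub_eq_add_neg]
  have hMi := hM.2
  have hMc := hM.1
  rw [mellin, hf] at hMi
  rw [MellinConvergent, hf] at hMc
  refine ⟨hMc, hMi.trans ?_⟩
  have e1 : Complex.sin (((Real.pi - θ : ℝ) : ℂ) * (Complex.I * ξ + 1 - 1)) =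
      Complex.sinh (ξ * (Real.pi - θ)) * Complex.I := by
    rw [← Complex.sin_mul_I]
    congr 1
    push_cast
    ring
  have e2 : Complex.sin (Real.pi * (Complex.I * ξ + 1)) =
      Complex.I * Complex.sinh ((starRingEnd ℂ) ξ * Real.pi) := by
    have hc : (starRingEnd ℂ) ξ = ξ - Complex.I := by
      rw [hξ, map_add, map_div₀, Complex.conj_ofReal, Complex.conj_I, Complex.conj_ofNat]
      ring
    rw [hc, show (ξ - Complex.I) * Real.pi = ξ * Real.pi - Real.pi * Complex.I by ring,
      Complex.sinh_sub, Complex.sinh_mul_I, Complex.cosh_mul_I, mul_add, mul_one,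
      Complex.sin_add_pi, show (Real.pi : ℂ) * (Complex.I * ξ) = ξ * Real.pi * Complex.I by ring,
      Complex.sin_mul_I, Complex.sin_pi, Complex.cos_pi]
    ring
  rw [e1, e2, Real.sin_pi_sub, ← mul_assoc, mul_left_comm, mul_comm _ Complex.I,
    mul_div_mul_left _ _ Complex.I_ne_zero]
end
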